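/- arXiv:2605.25123 — 6 statements merged into one kernel-verified Lean document; each statement's English description precedes it below -/
import Mathlib

section
/- Let P and π be probability measures on a measurable space Ω with π ≪ P and P ≪ π, and let R = dπ/dP. Fix λ ≥ 0 and suppose 0 < ∫ R^{1/(1+λ)} dP < ∞. Define the probability measure q* by dq*/dP = R^{1/(1+λ)} / ∫ R^{1/(1+λ)} dP. Then q* minimizes the Lagrangian functional q ↦ D_KL(q‖π) + λ · D_KL(q‖P) over all probability measures q on Ω that are absolutely continuous with respect to P. -/
open MeasureTheory

/-- Kullback–Leibler divergence, `EReal`-valued: `∫ log (dq/dp) dq` when `q ≪ p`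
and the log-likelihood ratio is integrable, and `⊤` otherwise. -/
noncomputable def klDiv {Ω : Type*} [MeasurableSpace Ω] (q p : Measure Ω) : EReal :=
  open Classical in
  if q ≪ p ∧ Integrable (llr q p) q then ((∫ x, llr q p x ∂q : ℝ) : EReal) else ⊤

/-- Gibbs' inequality for probability measures. -/
theorem klDiv_nonneg {Ω : Type*} [MeasurableSpace Ω] (q p : Measure Ω)
    [IsProbabilityMeasure q] [IsProbabilityMeasure p] : 0 ≤ klDiv q p := by
  unfold klDiv
  split_ifs with h
  · have := InformationTheory.integral_llr_add_sub_measure_univ_nonneg h.1 h.2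
    simpa using this
  · exact le_top

theorem klDiv_of_integrable {Ω : Type*} [MeasurableSpace Ω] {q p : Measure Ω}
    (hqp : q ≪ p) (h : Integrable (llr q p) q) :
    klDiv q p = ((∫ x, llr q p x ∂q : ℝ) : EReal) :=
  if_pos ⟨hqp, h⟩

theorem klDiv_self {Ω : Type*} [MeasurableSpace Ω] (p : Measure Ω) [SigmaFinite p] :
    klDiv p p = 0 := by
  have h := llr_self p
  rw [klDiv_of_integrable Measure.AbsolutelyContinuous.rfl
    ((integrable_zero _ _ p).congr h.symm), integral_congr_ae h]
  simp

theorem integrable_llr_of_klDiv_ne_top {Ω : Type*} [MeasurableSpace Ω] {q p : Measure Ω}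
    (h : klDiv q p ≠ ⊤) : Integrable (llr q p) q := by
  contrapose! h
  exact if_neg fun h' => h h'.2

/-- Chain rule for log-likelihood ratios. -/
theorem llr_eq_llr_sub_llr {Ω : Type*} [MeasurableSpace Ω] {q p r : Measure Ω}
    [SigmaFinite q] [SigmaFinite p] [SigmaFinite r] (hqp : q ≪ p) (hpr : p ≪ r) :
    llr q p =ᵐ[q] fun x => llr q r x - llr p r x := by
  have hqr := hqp.trans hpr
  filter_upwards [hqr.ae_le (Measure.rnDeriv_mul_rnDeriv (κ := r) hqp), Measure.rnDeriv_pos hqp,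
    hqp.ae_le (Measure.rnDeriv_pos hpr), hqp.ae_le (Measure.rnDeriv_lt_top q p),
    hqr.ae_le (Measure.rnDeriv_lt_top p r)] with x hx h1 h2 h3 h4
  rw [llr, llr, llr, ← hx, Pi.mul_apply, ENNReal.toReal_mul,
    Real.log_mul (ENNReal.toReal_pos h1.ne' h3.ne).ne' (ENNReal.toReal_pos h2.ne' h4.ne).ne']
  ring

/-- The Lagrangian is, up to an additive constant, `1 + λ` times the divergence to the
tempered measure. -/
theorem lagrangian_eq {Ω : Type*} [MeasurableSpace Ω] {P p q : Measure Ω}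
    [IsProbabilityMeasure P] [IsProbabilityMeasure p] [IsProbabilityMeasure q]
    (hpP : p ≪ P) (hPp : P ≪ p) (hqP : q ≪ P) {c : ℝ} (hc : 0 ≤ c)
    (hexp : Integrable (fun x => Real.exp (llr p P x / (1 + c))) P)
    (hq : Integrable (llr q P) q) (hp : Integrable (llr p P) q) :
    klDiv q p + (c : EReal) * klDiv q P =
      (((1 + c) * (∫ x, llr q (P.tilted fun x => llr p P x / (1 + c)) x ∂q
        - Real.log (∫ x, Real.exp (llr p P x / (1 + c)) ∂P)) : ℝ) : EReal) := by
  have hchain := llr_eq_llr_sub_llr (hqP.trans hPp) hpP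
  rw [klDiv_of_integrable (hqP.trans hPp) ((hq.sub hp).congr hchain.symm),
    klDiv_of_integrable hqP hq, integral_congr_ae hchain, integral_sub hq hp,
    integral_llr_tilted_right hqP (hp.div_const _) hexp hq, integral_div,
    ← EReal.coe_mul, ← EReal.coe_add]
  congr 1
  have : 1 + c ≠ 0 := by positivity
  field_simp
  ring

/-- The log-likelihood ratio is integrable against intermediate temperings. -/
theorem integrable_llr_tilted_div {Ω : Type*} [MeasurableSpace Ω] {P p : Measure Ω}
    [IsProbabilityMeasure P] [IsProbabilityMeasure p] (hPp : P ≪ p) {c : ℝ} (hc : 0 < c)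
    (hexp : Integrable (fun x => Real.exp (llr p P x / (1 + c))) P) :
    Integrable (llr p P) (P.tilted fun x => llr p P x / (1 + c)) := by
  have h0 : (0 : ℝ) ∈ ProbabilityTheory.integrableExpSet (llr p P) P := by
    simp [ProbabilityTheory.integrableExpSet]
  have h1 : (1 : ℝ) ∈ ProbabilityTheory.integrableExpSet (llr p P) P := by
    simpa [ProbabilityTheory.integrableExpSet] using
      Measure.integrable_toReal_rnDeriv.congr (exp_llr_of_ac' p P hPp).symm
  have hsub : Set.Icc (0 : ℝ) 1 ⊆ ProbabilityTheory.integrableExpSet (llr p P) P :=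
    ProbabilityTheory.convex_integrableExpSet.ordConnected.out h0 h1
  have hmem : 1 / (1 + c) ∈ interior (ProbabilityTheory.integrableExpSet (llr p P) P) := by
    refine interior_mono hsub ?_
    rw [interior_Icc]
    exact ⟨by positivity, by rw [div_lt_one (by positivity)]; linarith⟩
  rw [integrable_tilted_iff hexp]
  refine (ProbabilityTheory.integrable_pow_mul_exp_of_mem_interior_integrableExpSet hmem 1).congr
    (.of_forall fun x => ?_)
  simp only [pow_one, smul_eq_mul]
  rw [mul_comm, one_div_mul_eq_div]

/-- The tempered reweighting `dq*/dP ∝ R^{1/(1+λ)}` minimizes the Lagrangian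
`q ↦ D_KL(q‖π) + λ D_KL(q‖P)` over probability measures `q ≪ P`. -/
theorem tempered_update_minimizes_lagrangian
    {Ω : Type*} [MeasurableSpace Ω] (P pi : Measure Ω)
    [IsProbabilityMeasure P] [IsProbabilityMeasure pi]
    (hπP : pi ≪ P) (hPπ : P ≪ pi)
    (R : Ω → ℝ) (hR : R = fun x => (pi.rnDeriv P x).toReal)
    (lam : ℝ) (hlam : 0 ≤ lam)
    (hint : Integrable (fun x => R x ^ (1 / (1 + lam))) P)
    (hpos : 0 < ∫ x, R x ^ (1 / (1 + lam)) ∂P)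
    (qstar : Measure Ω)
    (hqstar : qstar = P.withDensity (fun x =>
      ENNReal.ofReal (R x ^ (1 / (1 + lam)) / ∫ y, R y ^ (1 / (1 + lam)) ∂P))) :
    ∀ q : Measure Ω, IsProbabilityMeasure q → q ≪ P →
      klDiv qstar pi + (lam : EReal) * klDiv qstar P
        ≤ klDiv q pi + (lam : EReal) * klDiv q P := by
  intro q _ hqP
  obtain rfl | hlam' := hlam.eq_or_lt
  · have hq : qstar = pi := by
      have hI : ∫ y, R y ∂P = 1 := by
        rw [hR, Measure.integral_toReal_rnDeriv hπP]
        simp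
      rw [hqstar, ← Measure.withDensity_rnDeriv_eq pi P hπP]
      refine withDensity_congr_ae ?_
      filter_upwards [Measure.rnDeriv_lt_top pi P] with x hx
      simp only [add_zero, div_one, Real.rpow_one, hI]
      rw [hR, ENNReal.ofReal_toReal hx.ne]
    simpa [hq, klDiv_self] using klDiv_nonneg q pi
  have hRexp : (fun x => R x ^ (1 / (1 + lam)))
      =ᵐ[P] fun x => Real.exp (llr pi P x / (1 + lam)) := by
    filter_upwards [exp_llr_of_ac' pi P hPπ] with x hx
    simp only [hR, ← hx, ← Real.exp_mul, mul_one_div]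
  have hexp := hint.congr hRexp
  have hq : qstar = P.tilted fun x => llr pi P x / (1 + lam) := by
    rw [hqstar, Measure.tilted, integral_congr_ae hRexp]
    refine withDensity_congr_ae ?_
    filter_upwards [hRexp] with x hx
    rw [hx]
  have hprob : IsProbabilityMeasure (P.tilted fun x => llr pi P x / (1 + lam)) :=
    isProbabilityMeasure_tilted hexp
  have hac := tilted_absolutelyContinuous P fun x => llr pi P x / (1 + lam)
  have hr := integrable_llr_tilted_div hPπ hlam' hexp
  have hstar : Integrable (llr (P.tilted fun x => llr pi P x / (1 + lam)) P)
      (P.tilted fun x => llr pi P x / (1 + lam)) :=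
    ((hr.div_const _).sub (integrable_const _)).congr
      (hac.ae_eq (log_rnDeriv_tilted_left_self hexp)).symm
  rw [hq, lagrangian_eq hπP hPπ hac hlam hexp hstar hr, integral_congr_ae (llr_self _)]
  by_cases h1 : klDiv q P = ⊤
  · rw [h1, EReal.coe_mul_top_of_pos hlam',
      EReal.add_top_of_ne_bot (EReal.bot_lt_zero.trans_le (klDiv_nonneg q pi)).ne']
    exact le_top
  by_cases h2 : klDiv q pi = ⊤
  · rw [h2, EReal.top_add_of_ne_bot]
    · exact le_top
    · exact (EReal.bot_lt_zero.trans_le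
        (mul_nonneg (EReal.coe_nonneg.2 hlam) (klDiv_nonneg q P))).ne'
  have hqI := integrable_llr_of_klDiv_ne_top h1
  have hrq : Integrable (llr pi P) q := by
    refine (hqI.sub (integrable_llr_of_klDiv_ne_top h2)).congr ?_
    filter_upwards [llr_eq_llr_sub_llr (hqP.trans hPπ) hπP] with x hx
    rw [Pi.sub_apply, hx]
    ring
  rw [lagrangian_eq hπP hPπ hqP hlam hexp hqI hrq, EReal.coe_le_coe_iff]
  have hgibbs := InformationTheory.integral_llr_add_sub_measure_univ_nonneg
    (hqP.trans (absolutelyContinuous_tilted hexp))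
    (integrable_llr_tilted_right hqP (hrq.div_const _) hqI hexp)
  simp only [probReal_univ, add_sub_cancel_right] at hgibbs
  gcongr
  simpa using hgibbs
end

section
/- Let P and π be probability measures on a measurable space Ω with π ≪ P and P ≪ π, and let R = dπ/dP. Define Λ(τ) = log ∫ R^τ dP and, for τ with 0 < ∫ R^τ dP < ∞, the escort measure q_τ by dq_τ/dP = R^τ / ∫ R^τ dP. Suppose that for every τ ∈ [0,1], ∫ R^τ |log R|² dP < ∞. Then for every τ ∈ (0,1), Λ is differentiable at τ with Λ'(τ) = ∫ (log R) dq_τ, the expectation of log R under the escort measure q_τ. -/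
open MeasureTheory


open MeasureTheory

/-- The log-partition function `Λ(τ) = log ∫ R^τ dP` of the escort family is
differentiable on `(0,1)` with `Λ'(τ) = ∫ log R dq_τ`. -/
theorem escort_logPartition_hasDerivAt
    {Ω : Type*} [MeasurableSpace Ω] (P pi : Measure Ω)
    [IsProbabilityMeasure P] [IsProbabilityMeasure pi]
    (hπP : pi ≪ P) (hPπ : P ≪ pi)
    (R : Ω → ℝ) (hR : R = fun x => (pi.rnDeriv P x).toReal)
    (hmom : ∀ τ ∈ Set.Icc (0 : ℝ) 1,
      Integrable (fun x => R x ^ τ * |Real.log (R x)| ^ 2) P)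
    (Λ : ℝ → ℝ) (hΛ : ∀ τ, Λ τ = Real.log (∫ x, R x ^ τ ∂P))
    (q : ℝ → Measure Ω)
    (hq : ∀ τ, q τ = P.withDensity (fun x =>
      ENNReal.ofReal (R x ^ τ / ∫ y, R y ^ τ ∂P))) :
    ∀ τ ∈ Set.Ioo (0 : ℝ) 1,
      HasDerivAt Λ (∫ x, Real.log (R x) ∂(q τ)) τ := by
  intro τ hτ
  have hpos : ∀ᵐ x ∂P, 0 < R x := by
    filter_upwards [Measure.rnDeriv_pos' hPπ, pi.rnDeriv_lt_top P] with x hx hx'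
    rw [hR]
    exact ENNReal.toReal_pos hx.ne' hx'.ne
  have hexp : ∀ t : ℝ, (fun x => R x ^ t) =ᵐ[P] fun x => Real.exp (t * Real.log (R x)) := by
    intro t
    filter_upwards [hpos] with x hx
    rw [Real.rpow_def_of_pos hx, mul_comm]
  have h_one : (1 : ℝ) ∈ ProbabilityTheory.integrableExpSet (fun x => Real.log (R x)) P := by
    have hint : Integrable (fun x => R x ^ (1 : ℝ)) P := by
      simpa only [Real.rpow_one, hR] using Measure.integrable_toReal_rnDeriv
    exact hint.congr (hexp 1)
  have h_zero : (0 : ℝ) ∈ ProbabilityTheory.integrableExpSet (fun x => Real.log (R x)) P := by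
    simp [ProbabilityTheory.integrableExpSet]
  have hmem : τ ∈ interior (ProbabilityTheory.integrableExpSet (fun x => Real.log (R x)) P) := by
    refine interior_maximal (fun t ht => ?_) isOpen_Ioo hτ
    exact ProbabilityTheory.convex_integrableExpSet.ordConnected.out h_zero h_one
      (Set.Ioo_subset_Icc_self ht)
  have hcgf : Λ = ProbabilityTheory.cgf (fun x => Real.log (R x)) P := by
    funext t
    rw [hΛ, integral_congr_ae (hexp t), ProbabilityTheory.cgf, ProbabilityTheory.mgf]
  have htilt : q τ = P.tilted (fun x => τ * Real.log (R x)) := by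
    rw [hq, Measure.tilted, integral_congr_ae (hexp τ)]
    refine withDensity_congr_ae ?_
    filter_upwards [hexp τ] with x hx
    rw [hx]
  rw [htilt, ProbabilityTheory.integral_tilted_mul_self hmem, hcgf]
  exact (ProbabilityTheory.analyticAt_cgf hmem).differentiableAt.hasDerivAt
end

section
/- Let P and π be probability measures on a measurable space Ω with π ≪ P and P ≪ π, and let R = dπ/dP. Define Λ(τ) = log ∫ R^τ dP and the escort measure q_τ by dq_τ/dP = R^τ / ∫ R^τ dP. Suppose that for every τ ∈ [0,1], ∫ R^τ |log R|² dP < ∞. Then for every τ ∈ (0,1), Λ is twice differentiable at τ with Λ''(τ) = Var_{q_τ}(log R), the variance of log R under the escort measure q_τ. -/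
open MeasureTheory

open ProbabilityTheory

/-- The second derivative of the cumulant generating function, as a derivative statement, is the
variance under the exponentially tilted measure, written as a difference of moments. -/
lemma hasDerivAt_deriv_cgf_tilted {Ω : Type*} [MeasurableSpace Ω] {μ : Measure Ω} [NeZero μ]
    {X : Ω → ℝ} {t : ℝ} (ht : t ∈ interior (integrableExpSet X μ)) :
    HasDerivAt (deriv (cgf X μ))
      ((∫ x, X x ^ 2 ∂(μ.tilted (t * X ·))) - (∫ x, X x ∂(μ.tilted (t * X ·))) ^ 2) t := by
  have : IsProbabilityMeasure (μ.tilted (t * X ·)) :=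
    isProbabilityMeasure_tilted (interior_subset (s := integrableExpSet X μ) ht)
  have hvar := variance_eq_sub (memLp_tilted_mul ht 2)
  simp only [Pi.pow_apply] at hvar
  rw [← hvar, variance_tilted_mul ht, iteratedDeriv_succ, iteratedDeriv_one]
  exact (analyticAt_cgf ht).deriv.differentiableAt.hasDerivAt

/-- If the exponential of `X` is integrable for a finite measure, the open unit interval lies in the
interior of the domain of the moment generating function. -/
lemma Ioo_zero_one_subset_interior_integrableExpSet {Ω : Type*} [MeasurableSpace Ω]
    {μ : Measure Ω} [IsFiniteMeasure μ] {X : Ω → ℝ}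
    (hX : Integrable (fun x => Real.exp (X x)) μ) :
    Set.Ioo (0 : ℝ) 1 ⊆ interior (integrableExpSet X μ) := by
  have h0 : (0 : ℝ) ∈ integrableExpSet X μ := by simp [integrableExpSet]
  have h1 : (1 : ℝ) ∈ integrableExpSet X μ := by simpa [integrableExpSet] using hX
  exact interior_maximal
    (Set.Ioo_subset_Icc_self.trans (convex_integrableExpSet.ordConnected.out h0 h1)) isOpen_Ioo

/-- The log-partition function `Λ(τ) = log ∫ R^τ dP` of the escort family is
twice differentiable on `(0,1)` with `Λ''(τ) = Var_{q_τ}(log R)`. -/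
theorem escort_logPartition_second_deriv
    {Ω : Type*} [MeasurableSpace Ω] (P pi : Measure Ω)
    [IsProbabilityMeasure P] [IsProbabilityMeasure pi]
    (hπP : pi ≪ P) (hPπ : P ≪ pi)
    (R : Ω → ℝ) (hR : R = fun x => (pi.rnDeriv P x).toReal)
    (hmom : ∀ τ ∈ Set.Icc (0 : ℝ) 1,
      Integrable (fun x => R x ^ τ * |Real.log (R x)| ^ 2) P)
    (Λ : ℝ → ℝ) (hΛ : ∀ τ, Λ τ = Real.log (∫ x, R x ^ τ ∂P))
    (q : ℝ → Measure Ω)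
    (hq : ∀ τ, q τ = P.withDensity (fun x =>
      ENNReal.ofReal (R x ^ τ / ∫ y, R y ^ τ ∂P))) :
    ∀ τ ∈ Set.Ioo (0 : ℝ) 1,
      DifferentiableAt ℝ Λ τ ∧
      HasDerivAt (deriv Λ)
        ((∫ x, Real.log (R x) ^ 2 ∂(q τ)) - (∫ x, Real.log (R x) ∂(q τ)) ^ 2) τ := by
  have hpos : ∀ᵐ x ∂P, 0 < R x := by
    filter_upwards [Measure.rnDeriv_pos' hPπ, pi.rnDeriv_lt_top P] with x hx hx'
    simpa [hR] using ENNReal.toReal_pos hx.ne' hx'.ne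
  have hrpow (t : ℝ) : (fun x => R x ^ t) =ᵐ[P] fun x => Real.exp (t * Real.log (R x)) := by
    filter_upwards [hpos] with x hx
    rw [Real.rpow_def_of_pos hx, mul_comm]
  have hexp : Integrable (fun x => Real.exp (Real.log (R x))) P := by
    have hint : Integrable R P := hR ▸ Measure.integrable_toReal_rnDeriv
    refine hint.congr ?_
    filter_upwards [hpos] with x hx
    rw [Real.exp_log hx]
  have hΛ' : Λ = cgf (fun x => Real.log (R x)) P := by
    ext t
    rw [hΛ, integral_congr_ae (hrpow t), cgf, mgf]
  have hq' (t : ℝ) : q t = P.tilted (fun x => t * Real.log (R x)) := by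
    rw [hq, Measure.tilted, integral_congr_ae (hrpow t)]
    refine withDensity_congr_ae ?_
    filter_upwards [hrpow t] with x hx
    rw [hx]
  intro τ hτ
  have hmem := Ioo_zero_one_subset_interior_integrableExpSet hexp hτ
  rw [hΛ', hq']
  exact ⟨(analyticAt_cgf hmem).differentiableAt, hasDerivAt_deriv_cgf_tilted hmem⟩
end

section
/- Let P and π be probability measures on a measurable space Ω with π ≪ P and P ≪ π, let R = dπ/dP, and suppose R is square-integrable with respect to P. Define Λ(τ) = log ∫ R^τ dP and the escort measure q_τ by dq_τ/dP = R^τ / ∫ R^τ dP. Then for every τ ∈ [0,1], the chi-squared divergence of π from q_τ satisfies the closed-form identity 1 + χ²(π‖q_τ) = exp(Λ(τ) + Λ(2 − τ)). -/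
open MeasureTheory

lemma Real.rpow_le_one_add_sq {r s : ℝ} (hr : 0 ≤ r) (hs0 : 0 ≤ s) (hs2 : s ≤ 2) :
    r ^ s ≤ 1 + r ^ 2 := by
  rcases le_total r 1 with h | h
  · nlinarith [Real.rpow_le_one hr h hs0, sq_nonneg r]
  · have := Real.rpow_le_rpow_of_exponent_le h hs2
    rw [Real.rpow_two] at this
    linarith

lemma integrable_rpow_of_integrable_sq {Ω : Type*} [MeasurableSpace Ω] {P : Measure Ω}
    [IsFiniteMeasure P] {R : Ω → ℝ} (hRm : Measurable R) (hR0 : ∀ x, 0 ≤ R x)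
    (hsq : Integrable (fun x => R x ^ 2) P) {s : ℝ} (hs0 : 0 ≤ s) (hs2 : s ≤ 2) :
    Integrable (fun x => R x ^ s) P := by
  refine ((integrable_const (1 : ℝ)).add hsq).mono' (hRm.pow_const s).aestronglyMeasurable ?_
  refine Filter.Eventually.of_forall fun x => ?_
  rw [Real.norm_of_nonneg (Real.rpow_nonneg (hR0 x) s)]
  exact Real.rpow_le_one_add_sq (hR0 x) hs0 hs2

lemma integral_pos_of_ae_pos {Ω : Type*} [MeasurableSpace Ω] {P : Measure Ω} [NeZero P]
    {f : Ω → ℝ} (hf : Integrable f P) (hpos : ∀ᵐ x ∂P, 0 < f x) : 0 < ∫ x, f x ∂P := by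
  have h0 : 0 ≤ᵐ[P] f := hpos.mono fun x hx => hx.le
  refine (integral_nonneg_of_ae h0).lt_of_ne' fun h => ?_
  rw [integral_eq_zero_iff_of_nonneg_ae h0 hf] at h
  obtain ⟨x, hx, hx'⟩ := (hpos.and h).exists
  exact hx.ne' hx'

/-- Closed form for the chi-squared divergence along the escort path:
`1 + χ²(π‖q_τ) = exp(Λ(τ) + Λ(2−τ))` for `τ ∈ [0,1]`. -/
theorem escort_chiSq_closed_form
    {Ω : Type*} [MeasurableSpace Ω] (P pi : Measure Ω)
    [IsProbabilityMeasure P] [IsProbabilityMeasure pi]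
    (hπP : pi ≪ P) (hPπ : P ≪ pi)
    (R : Ω → ℝ) (hR : R = fun x => (pi.rnDeriv P x).toReal)
    (hsq : Integrable (fun x => R x ^ 2) P)
    (Λ : ℝ → ℝ) (hΛ : ∀ τ, Λ τ = Real.log (∫ x, R x ^ τ ∂P))
    (q : ℝ → Measure Ω)
    (hq : ∀ τ, q τ = P.withDensity (fun x =>
      ENNReal.ofReal (R x ^ τ / ∫ y, R y ^ τ ∂P))) :
    ∀ τ ∈ Set.Icc (0 : ℝ) 1,
      1 + ∫ x, ((pi.rnDeriv (q τ) x).toReal - 1) ^ 2 ∂(q τ)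
        = Real.exp (Λ τ + Λ (2 - τ)) := by
  rintro τ ⟨hτ0, hτ1⟩
  have hRm : Measurable R := hR ▸ (Measure.measurable_rnDeriv pi P).ennreal_toReal
  have hR0 : ∀ x, 0 ≤ R x := fun x => by rw [hR]; exact ENNReal.toReal_nonneg
  have hRpos : ∀ᵐ x ∂P, 0 < R x := by
    filter_upwards [Measure.rnDeriv_pos' hPπ, Measure.rnDeriv_ne_top pi P] with x h1 h2
    rw [hR]
    exact ENNReal.toReal_pos h1.ne' h2
  have hR1 : ∫ x, R x ∂P = 1 := by
    rw [hR, Measure.integral_toReal_rnDeriv hπP]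
    simp
  have hRint : Integrable R P := hR ▸ Measure.integrable_toReal_rnDeriv
  have hI₁ : Integrable (fun x => R x ^ τ) P :=
    integrable_rpow_of_integrable_sq hRm hR0 hsq hτ0 (by linarith)
  have hI₂ : Integrable (fun x => R x ^ (2 - τ)) P :=
    integrable_rpow_of_integrable_sq hRm hR0 hsq (by linarith) (by linarith)
  have hZ : 0 < ∫ x, R x ^ τ ∂P :=
    integral_pos_of_ae_pos hI₁ (hRpos.mono fun x hx => Real.rpow_pos_of_pos hx _)
  have hW : 0 < ∫ x, R x ^ (2 - τ) ∂P :=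
    integral_pos_of_ae_pos hI₂ (hRpos.mono fun x hx => Real.rpow_pos_of_pos hx _)
  rw [hΛ, hΛ, Real.exp_add, Real.exp_log hZ, Real.exp_log hW, hq]
  set Z := ∫ x, R x ^ τ ∂P with hZdef
  have hgm : Measurable fun x => ENNReal.ofReal (R x ^ τ / Z) :=
    ((hRm.pow_const τ).div_const Z).ennreal_ofReal
  have hrn := Measure.rnDeriv_withDensity_right pi P hgm.aemeasurable
    (hRpos.mono fun x hx =>
      (ENNReal.ofReal_pos.2 (div_pos (Real.rpow_pos_of_pos hx τ) hZ)).ne')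
    (Filter.Eventually.of_forall fun x => ENNReal.ofReal_ne_top)
  rw [integral_withDensity_eq_integral_toReal_smul hgm
    (Filter.Eventually.of_forall fun x => ENNReal.ofReal_lt_top)]
  have hae : (fun x => (ENNReal.ofReal (R x ^ τ / Z)).toReal •
      ((pi.rnDeriv (P.withDensity fun x => ENNReal.ofReal (R x ^ τ / Z)) x).toReal - 1) ^ 2)
      =ᵐ[P] fun x => Z * R x ^ (2 - τ) - 2 * R x + R x ^ τ / Z := by
    filter_upwards [hrn, hRpos] with x hx hpos
    have hp := Real.rpow_pos_of_pos hpos τ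
    have hRx : (pi.rnDeriv P x).toReal = R x := by rw [hR]
    rw [hx, ENNReal.toReal_mul, ENNReal.toReal_inv, hRx,
      ENNReal.toReal_ofReal (div_pos hp hZ).le, Real.rpow_sub hpos, Real.rpow_two, smul_eq_mul]
    field_simp
    ring
  have hsub : Integrable (fun x => Z * R x ^ (2 - τ) - 2 * R x) P :=
    (hI₂.const_mul Z).sub (hRint.const_mul 2)
  rw [integral_congr_ae hae, integral_add hsub (hI₁.div_const Z),
    integral_sub (hI₂.const_mul Z) (hRint.const_mul 2), integral_const_mul,
    integral_const_mul, integral_div, hR1, ← hZdef, div_self hZ.ne']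
  ring
end

section
/- Let P and π be probability measures on a measurable space Ω with π ≪ P and P ≪ π, let R = dπ/dP, and suppose R is square-integrable with respect to P. Define the escort measure q_τ by dq_τ/dP = R^τ / ∫ R^τ dP. Then the map τ ↦ χ²(π‖q_τ) is nonincreasing on [0,1]; moreover, if P ≠ π, it is strictly decreasing on [0,1). -/
open MeasureTheory

theorem rpow_add_rpow_two_sub_sub_eq {a b : ℝ} (ha : 0 < a) (hb : 0 < b) (s t : ℝ) :
    a ^ s * b ^ (2 - s) + a ^ (2 - s) * b ^ s - (a ^ t * b ^ (2 - t) + a ^ (2 - t) * b ^ t) =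
      a ^ s * b ^ s * ((a ^ (t - s) - b ^ (t - s)) * (a ^ (2 - s - t) - b ^ (2 - s - t))) := by
  have key : ∀ c : ℝ, 0 < c → c ^ (2 - s) = c ^ s * c ^ (t - s) * c ^ (2 - s - t) ∧
      c ^ t = c ^ s * c ^ (t - s) ∧ c ^ (2 - t) = c ^ s * c ^ (2 - s - t) := by
    intro c hc
    simp only [← Real.rpow_add hc]
    refine ⟨?_, ?_, ?_⟩ <;> congr 1 <;> ring
  obtain ⟨ha₁, ha₂, ha₃⟩ := key a ha
  obtain ⟨hb₁, hb₂, hb₃⟩ := key b hb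
  rw [ha₁, ha₂, ha₃, hb₁, hb₂, hb₃]
  ring

theorem rpow_sub_rpow_mul_rpow_sub_rpow_pos {a b : ℝ} (ha : 0 < a) (hb : 0 < b) (hab : a ≠ b)
    {p r : ℝ} (hp : 0 < p) (hr : 0 < r) : 0 < (a ^ p - b ^ p) * (a ^ r - b ^ r) := by
  rcases lt_or_gt_of_ne hab with h | h
  · exact mul_pos_of_neg_of_neg (sub_neg.2 (Real.rpow_lt_rpow ha.le h hp))
      (sub_neg.2 (Real.rpow_lt_rpow ha.le h hr))
  · exact mul_pos (sub_pos.2 (Real.rpow_lt_rpow hb.le h hp))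
      (sub_pos.2 (Real.rpow_lt_rpow hb.le h hr))

theorem rpow_add_rpow_two_sub_lt {a b : ℝ} (ha : 0 < a) (hb : 0 < b) (hab : a ≠ b)
    {s t : ℝ} (hst : s < t) (ht : t ≤ 1) :
    a ^ t * b ^ (2 - t) + a ^ (2 - t) * b ^ t < a ^ s * b ^ (2 - s) + a ^ (2 - s) * b ^ s := by
  rw [← sub_pos, rpow_add_rpow_two_sub_sub_eq ha hb]
  have := rpow_sub_rpow_mul_rpow_sub_rpow_pos ha hb hab (p := t - s) (r := 2 - s - t)
    (by linarith) (by linarith)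
  positivity

theorem rpow_add_rpow_two_sub_le {a b : ℝ} (ha : 0 < a) (hb : 0 < b)
    {s t : ℝ} (hst : s < t) (ht : t ≤ 1) :
    a ^ t * b ^ (2 - t) + a ^ (2 - t) * b ^ t ≤ a ^ s * b ^ (2 - s) + a ^ (2 - s) * b ^ s := by
  rcases eq_or_ne a b with rfl | hab
  · simp only [← Real.rpow_add ha]
    ring_nf
    exact le_rfl
  · exact (rpow_add_rpow_two_sub_lt ha hb hab hst ht).le

section Moments

variable {Ω : Type*} [MeasurableSpace Ω] {μ : Measure Ω} {f : Ω → ℝ}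

theorem integrable_rpow_of_integrable_sq_s14 [IsFiniteMeasure μ] (hf : Measurable f)
    (hpos : ∀ᵐ x ∂μ, 0 < f x) (hsq : Integrable (fun x => f x ^ 2) μ)
    {s : ℝ} (hs₀ : 0 ≤ s) (hs₂ : s ≤ 2) : Integrable (fun x => f x ^ s) μ := by
  refine ((integrable_const (1 : ℝ)).add hsq).mono' (hf.pow_const s).aestronglyMeasurable ?_
  filter_upwards [hpos] with x hx
  rw [Real.norm_of_nonneg (Real.rpow_nonneg hx.le s), Pi.add_apply]
  rcases le_total (f x) 1 with h | h
  · exact (Real.rpow_le_one hx.le h hs₀).trans (le_add_of_nonneg_right (sq_nonneg _))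
  · have := Real.rpow_le_rpow_of_exponent_le h hs₂
    rw [Real.rpow_two] at this
    linarith

theorem integrable_prod_rpow_add_rpow_two_sub [IsFiniteMeasure μ] (hf : Measurable f)
    (hpos : ∀ᵐ x ∂μ, 0 < f x) (hsq : Integrable (fun x => f x ^ 2) μ)
    {s : ℝ} (hs₀ : 0 ≤ s) (hs₂ : s ≤ 2) :
    Integrable (fun z : Ω × Ω => f z.1 ^ s * f z.2 ^ (2 - s) + f z.1 ^ (2 - s) * f z.2 ^ s)
      (μ.prod μ) := by
  have h₁ := integrable_rpow_of_integrable_sq_s14 hf hpos hsq hs₀ hs₂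
  have h₂ := integrable_rpow_of_integrable_sq_s14 hf hpos hsq
    (s := 2 - s) (by linarith) (by linarith)
  exact (h₁.mul_prod h₂).add (h₂.mul_prod h₁)

theorem integral_prod_rpow_add_rpow_two_sub [IsFiniteMeasure μ] (hf : Measurable f)
    (hpos : ∀ᵐ x ∂μ, 0 < f x) (hsq : Integrable (fun x => f x ^ 2) μ)
    {s : ℝ} (hs₀ : 0 ≤ s) (hs₂ : s ≤ 2) :
    ∫ z : Ω × Ω, (f z.1 ^ s * f z.2 ^ (2 - s) + f z.1 ^ (2 - s) * f z.2 ^ s) ∂(μ.prod μ) =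
      2 * ((∫ x, f x ^ s ∂μ) * ∫ x, f x ^ (2 - s) ∂μ) := by
  have h₁ := integrable_rpow_of_integrable_sq_s14 hf hpos hsq hs₀ hs₂
  have h₂ := integrable_rpow_of_integrable_sq_s14 hf hpos hsq
    (s := 2 - s) (by linarith) (by linarith)
  rw [integral_add (h₁.mul_prod h₂) (h₂.mul_prod h₁),
    integral_prod_mul (fun x => f x ^ s) (fun x => f x ^ (2 - s)),
    integral_prod_mul (fun x => f x ^ (2 - s)) (fun x => f x ^ s)]
  ring

theorem ae_prod_fst_snd_pos [SFinite μ] (hpos : ∀ᵐ x ∂μ, 0 < f x) :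
    ∀ᵐ z ∂(μ.prod μ), 0 < f z.1 ∧ 0 < f z.2 :=
  (Measure.quasiMeasurePreserving_fst.ae hpos).and (Measure.quasiMeasurePreserving_snd.ae hpos)

theorem integral_rpow_mul_integral_rpow_two_sub_le [IsFiniteMeasure μ] (hf : Measurable f)
    (hpos : ∀ᵐ x ∂μ, 0 < f x) (hsq : Integrable (fun x => f x ^ 2) μ)
    {s t : ℝ} (hs : 0 ≤ s) (hst : s < t) (ht : t ≤ 1) :
    (∫ x, f x ^ t ∂μ) * ∫ x, f x ^ (2 - t) ∂μ ≤ (∫ x, f x ^ s ∂μ) * ∫ x, f x ^ (2 - s) ∂μ := by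
  refine le_of_mul_le_mul_left ?_ (zero_lt_two' ℝ)
  rw [← integral_prod_rpow_add_rpow_two_sub hf hpos hsq (by linarith) (by linarith),
    ← integral_prod_rpow_add_rpow_two_sub hf hpos hsq (by linarith) (by linarith)]
  refine integral_mono_ae
    (integrable_prod_rpow_add_rpow_two_sub hf hpos hsq (by linarith) (by linarith))
    (integrable_prod_rpow_add_rpow_two_sub hf hpos hsq (by linarith) (by linarith)) ?_
  filter_upwards [ae_prod_fst_snd_pos hpos] with z hz
  exact rpow_add_rpow_two_sub_le hz.1 hz.2 hst ht

/-- Equality of the products at two distinct exponents forces `f` to be a.e. constant. -/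
theorem exists_ae_eq_const_of_integral_rpow_mul_eq [IsFiniteMeasure μ] [NeZero μ]
    (hf : Measurable f) (hpos : ∀ᵐ x ∂μ, 0 < f x) (hsq : Integrable (fun x => f x ^ 2) μ)
    {s t : ℝ} (hs : 0 ≤ s) (hst : s < t) (ht : t ≤ 1)
    (heq : (∫ x, f x ^ t ∂μ) * ∫ x, f x ^ (2 - t) ∂μ =
      (∫ x, f x ^ s ∂μ) * ∫ x, f x ^ (2 - s) ∂μ) :
    ∃ c, ∀ᵐ x ∂μ, f x = c := by
  have hle : ∀ᵐ z ∂(μ.prod μ), f z.1 ^ t * f z.2 ^ (2 - t) + f z.1 ^ (2 - t) * f z.2 ^ t ≤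
      f z.1 ^ s * f z.2 ^ (2 - s) + f z.1 ^ (2 - s) * f z.2 ^ s := by
    filter_upwards [ae_prod_fst_snd_pos hpos] with z hz
    exact rpow_add_rpow_two_sub_le hz.1 hz.2 hst ht
  have hae := (integral_eq_iff_of_ae_le
    (integrable_prod_rpow_add_rpow_two_sub hf hpos hsq (by linarith) (by linarith))
    (integrable_prod_rpow_add_rpow_two_sub hf hpos hsq (by linarith) (by linarith)) hle).1 (by
      rw [integral_prod_rpow_add_rpow_two_sub hf hpos hsq (by linarith) (by linarith),
        integral_prod_rpow_add_rpow_two_sub hf hpos hsq (by linarith) (by linarith), heq])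
  have hconst : ∀ᵐ z ∂(μ.prod μ), f z.2 = f z.1 := by
    filter_upwards [ae_prod_fst_snd_pos hpos, hae] with z hz hz'
    by_contra hne
    exact (rpow_add_rpow_two_sub_lt hz.1 hz.2 (Ne.symm hne) hst ht).ne hz'
  obtain ⟨x, hx⟩ := (Measure.ae_ae_of_ae_prod hconst).exists
  exact ⟨f x, hx⟩

end Moments

theorem integral_rnDeriv_withDensity_sub_one_sq {Ω : Type*} [MeasurableSpace Ω]
    {P ν : Measure Ω} [IsProbabilityMeasure P] [IsProbabilityMeasure ν] (hνP : ν ≪ P)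
    (hpos : ∀ᵐ x ∂P, 0 < (ν.rnDeriv P x).toReal)
    (hsq : Integrable (fun x => (ν.rnDeriv P x).toReal ^ 2) P)
    {τ : ℝ} (hτ₀ : 0 ≤ τ) (hτ₂ : τ ≤ 2) :
    let R := fun x => (ν.rnDeriv P x).toReal
    let q := P.withDensity (fun x => ENNReal.ofReal (R x ^ τ / ∫ y, R y ^ τ ∂P))
    ∫ x, ((ν.rnDeriv q x).toReal - 1) ^ 2 ∂q =
      (∫ x, R x ^ τ ∂P) * (∫ x, R x ^ (2 - τ) ∂P) - 1 := by
  intro R q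
  have hRm : Measurable R := (Measure.measurable_rnDeriv ν P).ennreal_toReal
  have h₁ := integrable_rpow_of_integrable_sq_s14 hRm hpos hsq hτ₀ hτ₂
  have h₂ := integrable_rpow_of_integrable_sq_s14 hRm hpos hsq
    (s := 2 - τ) (by linarith) (by linarith)
  set M := ∫ y, R y ^ τ ∂P with hM
  have hMpos : 0 < M := by
    refine (integral_pos_iff_support_of_nonneg_ae ?_ h₁).2 ?_
    · filter_upwards [hpos] with x hx using Real.rpow_nonneg hx.le τ
    · have hsupp : Function.support (fun x => R x ^ τ) =ᵐ[P] Set.univ := by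
        filter_upwards [hpos] with x hx
        exact propext (iff_of_true (Real.rpow_pos_of_pos hx τ).ne' trivial)
      rw [measure_congr hsupp]
      simp
  have hdm : Measurable fun x => ENNReal.ofReal (R x ^ τ / M) :=
    ((hRm.pow_const τ).div_const M).ennreal_ofReal
  have hrn := Measure.rnDeriv_withDensity_right ν P hdm.aemeasurable
    (by filter_upwards [hpos] with x hx
        exact (ENNReal.ofReal_pos.2 (div_pos (Real.rpow_pos_of_pos hx τ) hMpos)).ne')
    (ae_of_all _ fun x => ENNReal.ofReal_ne_top)
  have hR₁ : ∫ x, R x ∂P = 1 := by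
    simp [R, Measure.integral_toReal_rnDeriv hνP]
  rw [integral_withDensity_eq_integral_toReal_smul hdm
    (ae_of_all _ fun x => ENNReal.ofReal_lt_top)]
  have hcongr : ∀ᵐ x ∂P, (ENNReal.ofReal (R x ^ τ / M)).toReal •
      ((ν.rnDeriv q x).toReal - 1) ^ 2 = M * R x ^ (2 - τ) - 2 * R x + R x ^ τ / M := by
    filter_upwards [hpos, hrn] with x hx hx'
    have hRτ : 0 < R x ^ τ := Real.rpow_pos_of_pos hx τ
    have hR2 : R x ^ (2 - τ) = R x ^ 2 / R x ^ τ := by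
      rw [Real.rpow_sub hx, Real.rpow_two]
    have hq : (ν.rnDeriv q x).toReal = (R x ^ τ / M)⁻¹ * R x := by
      rw [hx', ENNReal.toReal_mul, ENNReal.toReal_inv, ENNReal.toReal_ofReal (by positivity)]
    rw [hq, ENNReal.toReal_ofReal (by positivity), hR2, smul_eq_mul]
    field_simp
    ring
  have hi₂ : Integrable (fun x => M * R x ^ (2 - τ)) P := h₂.const_mul M
  have hi₁ : Integrable (fun x => 2 * R x) P := Measure.integrable_toReal_rnDeriv.const_mul 2
  have hi₀ : Integrable (fun x => M * R x ^ (2 - τ) - 2 * R x) P := hi₂.sub hi₁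
  rw [integral_congr_ae hcongr, integral_add hi₀ (h₁.div_const M), integral_sub hi₂ hi₁,
    integral_const_mul, integral_const_mul, integral_div, hR₁, ← hM, div_self hMpos.ne']
  ring

theorem eq_of_rnDeriv_toReal_ae_eq_const {Ω : Type*} [MeasurableSpace Ω] {P ν : Measure Ω}
    [IsProbabilityMeasure P] [IsProbabilityMeasure ν] (hνP : ν ≪ P) {c : ℝ}
    (hc : ∀ᵐ x ∂P, (ν.rnDeriv P x).toReal = c) : P = ν := by
  have hc₁ : c = 1 := by
    have h := Measure.integral_toReal_rnDeriv hνP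
    rw [integral_congr_ae hc] at h
    simpa using h
  have h : ν.rnDeriv P =ᵐ[P] 1 := by
    filter_upwards [hc] with x hx
    rwa [hc₁, ENNReal.toReal_eq_one_iff] at hx
  rw [← Measure.withDensity_rnDeriv_eq ν P hνP, withDensity_congr_ae h, withDensity_one]

/-- Along the escort path, `τ ↦ χ²(π‖q_τ)` is nonincreasing on `[0,1]`, and is
strictly decreasing on `[0,1)` whenever `P ≠ π`. -/
theorem escort_chiSq_monotone
    {Ω : Type*} [MeasurableSpace Ω] (P pi : Measure Ω)
    [IsProbabilityMeasure P] [IsProbabilityMeasure pi]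
    (hπP : pi ≪ P) (hPπ : P ≪ pi)
    (R : Ω → ℝ) (hR : R = fun x => (pi.rnDeriv P x).toReal)
    (hsq : Integrable (fun x => R x ^ 2) P)
    (q : ℝ → Measure Ω)
    (hq : ∀ τ, q τ = P.withDensity (fun x =>
      ENNReal.ofReal (R x ^ τ / ∫ y, R y ^ τ ∂P)))
    (chiSq : ℝ → ℝ)
    (hchiSq : ∀ τ, chiSq τ = ∫ x, ((pi.rnDeriv (q τ) x).toReal - 1) ^ 2 ∂(q τ)) :
    AntitoneOn chiSq (Set.Icc (0 : ℝ) 1) ∧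
    (P ≠ pi → StrictAntiOn chiSq (Set.Ico (0 : ℝ) 1)) := by
  have hRm : Measurable R := hR ▸ (Measure.measurable_rnDeriv pi P).ennreal_toReal
  have hpos : ∀ᵐ x ∂P, 0 < R x := by
    filter_upwards [Measure.rnDeriv_pos' hPπ, Measure.rnDeriv_lt_top pi P] with x h₀ h₁
    rw [hR]
    exact ENNReal.toReal_pos h₀.ne' h₁.ne
  have hchi : ∀ τ, 0 ≤ τ → τ ≤ 1 →
      chiSq τ = (∫ x, R x ^ τ ∂P) * (∫ x, R x ^ (2 - τ) ∂P) - 1 := by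
    intro τ hτ₀ hτ₁
    subst hR
    rw [hchiSq, hq]
    exact integral_rnDeriv_withDensity_sub_one_sq hπP hpos hsq hτ₀ (by linarith)
  constructor
  · intro s hs t ht hst
    rcases hst.eq_or_lt with rfl | hst
    · exact le_rfl
    rw [hchi s hs.1 hs.2, hchi t ht.1 ht.2]
    exact sub_le_sub_right
      (integral_rpow_mul_integral_rpow_two_sub_le hRm hpos hsq hs.1 hst ht.2) 1
  · intro hne s hs t ht hst
    rw [hchi s hs.1 hs.2.le, hchi t ht.1 ht.2.le]
    refine sub_lt_sub_right (lt_of_le_of_ne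
      (integral_rpow_mul_integral_rpow_two_sub_le hRm hpos hsq hs.1 hst ht.2.le) fun heq => hne ?_) 1
    obtain ⟨c, hc⟩ :=
      exists_ae_eq_const_of_integral_rpow_mul_eq hRm hpos hsq hs.1 hst ht.2.le heq
    rw [hR] at hc
    exact eq_of_rnDeriv_toReal_ae_eq_const hπP hc
end

section
/- Let P, Q, Q', and π be probability measures on a measurable space Ω, mutually absolutely continuous, and let β ∈ ℝ and t ∈ ℝ. Suppose dQ/dP = c₁ · (dπ/dP)^β for some constant c₁ > 0 and dQ'/dQ = c₂ · (dπ/dQ)^t for some constant c₂ > 0 (P-almost everywhere). Then there exists a constant c₃ > 0 such that dQ'/dP = c₃ · (dπ/dP)^{β + (1−β)t} P-almost everywhere; that is, exact tempered updates move the proposal along a geometric annealing path from P toward π with exponent recursion β' = β + (1 − β)t. -/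
open MeasureTheory

/-- Geometric annealing path: if `dQ/dP = c₁ (dπ/dP)^β` and
`dQ'/dQ = c₂ (dπ/dQ)^t`, then `dQ'/dP = c₃ (dπ/dP)^{β+(1−β)t}` for some
constant `c₃ > 0`. -/
theorem geometric_annealing_path
    {Ω : Type*} [MeasurableSpace Ω] (P Q Q' pi : Measure Ω)
    [IsProbabilityMeasure P] [IsProbabilityMeasure Q]
    [IsProbabilityMeasure Q'] [IsProbabilityMeasure pi]
    (hQP : Q ≪ P) (hPQ : P ≪ Q)
    (hQ'P : Q' ≪ P) (hPQ' : P ≪ Q')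
    (hπP : pi ≪ P) (hPπ : P ≪ pi)
    (β t : ℝ) (c₁ c₂ : ℝ) (hc₁ : 0 < c₁) (hc₂ : 0 < c₂)
    (h₁ : ∀ᵐ x ∂P, (Q.rnDeriv P x).toReal = c₁ * (pi.rnDeriv P x).toReal ^ β)
    (h₂ : ∀ᵐ x ∂P, (Q'.rnDeriv Q x).toReal = c₂ * (pi.rnDeriv Q x).toReal ^ t) :
    ∃ c₃ : ℝ, 0 < c₃ ∧
      ∀ᵐ x ∂P, (Q'.rnDeriv P x).toReal
        = c₃ * (pi.rnDeriv P x).toReal ^ (β + (1 - β) * t) := by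
  refine ⟨c₂ * c₁ ^ (1 - t), by positivity, ?_⟩
  filter_upwards [h₁, h₂, Measure.rnDeriv_mul_rnDeriv (κ := P) (hQ'P.trans hPQ),
    Measure.rnDeriv_mul_rnDeriv (κ := P) (hπP.trans hPQ), Measure.rnDeriv_pos' hPπ,
    Measure.rnDeriv_ne_top pi P] with x hx₁ hx₂ hQ' hpi hpos hfin
  have hr : 0 < (pi.rnDeriv P x).toReal := ENNReal.toReal_pos hpos.ne' hfin
  have hq : 0 < (Q.rnDeriv P x).toReal := by rw [hx₁]; positivity
  have hdiv : (pi.rnDeriv Q x).toReal = (pi.rnDeriv P x).toReal / (Q.rnDeriv P x).toReal := by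
    rw [eq_div_iff hq.ne', ← ENNReal.toReal_mul, ← hpi, Pi.mul_apply]
  rw [← hQ', Pi.mul_apply, ENNReal.toReal_mul, hx₂, hdiv, hx₁]
  generalize (pi.rnDeriv P x).toReal = r at hr ⊢
  rw [Real.div_rpow hr.le (by positivity), Real.mul_rpow hc₁.le (by positivity),
    ← Real.rpow_mul hr.le, Real.rpow_sub hc₁, Real.rpow_one,
    show β + (1 - β) * t = β + t - β * t by ring, Real.rpow_sub hr, Real.rpow_add hr]
  field_simp
end
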